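/- Let v_1⋯v_n be the place-based non-inversion table of a permutation σ of {1,…,n}. Then j is a strong fixed point of σ if and only if v_j = j and v_k > j for all k with j < k ≤ n. -/

import Mathlib

/-- The place-based non-inversion table (PNT) of a permutation `σ` of
`{1,…,n}` (zero-indexed): `v_j = 1 + #{i < j : σ(i) < σ(j)}`. -/
def pnt {n : ℕ} (σ : Equiv.Perm (Fin n)) (j : Fin n) : ℕ :=
  1 + (Finset.univ.filter fun i : Fin n => i < j ∧ σ i < σ j).card

/-- If all earlier entries have smaller values, the PNT entry is as large as possible,
and conversely. -/
theorem pnt_eq_iff {n : ℕ} (σ : Equiv.Perm (Fin n)) (j : Fin n) :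
    pnt σ j = (j : ℕ) + 1 ↔ ∀ i < j, σ i < σ j := by
  have hsub : (Finset.univ.filter fun i : Fin n => i < j ∧ σ i < σ j) ⊆ Finset.Iio j := by
    intro i hi
    simp_all
  rw [pnt, add_comm, Nat.add_right_cancel_iff]
  constructor
  · intro h i hi
    have heq := Finset.eq_of_subset_of_card_le hsub (by simp [h])
    have hmem : i ∈ Finset.Iio j := Finset.mem_Iio.2 hi
    rw [← heq] at hmem
    exact (Finset.mem_filter.1 hmem).2.2
  · intro h
    rw [← Fin.card_Iio j]
    congr 1
    ext i
    simpa using h i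

/-- A PNT entry is at most the one-indexed value of the permutation. -/
theorem pnt_le_apply {n : ℕ} (σ : Equiv.Perm (Fin n)) (k : Fin n) :
    pnt σ k ≤ (σ k : ℕ) + 1 := by
  have h : (Finset.univ.filter fun i : Fin n => i < k ∧ σ i < σ k).card ≤
      (Finset.Iio (σ k)).card :=
    Finset.card_le_card_of_injOn σ (fun i hi => by simp_all) σ.injective.injOn
  rw [Fin.card_Iio] at h
  rw [pnt]
  omega

/-- A permutation preserves an initial segment iff it preserves the complementary
final segment. -/
theorem forall_apply_le_iff_forall_lt_apply {n : ℕ} (σ : Equiv.Perm (Fin n)) (j : Fin n) :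
    (∀ i ≤ j, σ i ≤ j) ↔ ∀ k, j < k → j < σ k := by
  constructor
  · intro h k hk
    by_contra! hle
    have := Equiv.Perm.perm_symm_on_of_perm_on_finset (s := Finset.Iic j) (f := σ)
      (by simpa using h) (Finset.mem_Iic.2 hle)
    simp at this
    omega
  · intro h i hi
    by_contra! hlt
    have := Equiv.Perm.perm_symm_on_of_perm_on_finset (s := Finset.Ioi j) (f := σ)
      (by simpa using h) (Finset.mem_Ioi.2 hlt)
    simp at this
    omega

/-- `j` (zero-indexed) is a strong fixed point of `σ` iff `v_j = j` and
`v_k > j` for all `k > j` (one-indexed statement). -/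
theorem strongFixedPoint_iff_pnt (n : ℕ) (σ : Equiv.Perm (Fin n)) (j : Fin n) :
    (σ j = j ∧ ∀ i : Fin n, i ≤ j → σ i ≤ j) ↔
      (pnt σ j = (j : ℕ) + 1 ∧ ∀ k : Fin n, j < k → (j : ℕ) + 1 < pnt σ k) := by
  rw [pnt_eq_iff, forall_apply_le_iff_forall_lt_apply]
  constructor
  · rintro ⟨hj, h⟩
    have hle := (forall_apply_le_iff_forall_lt_apply σ j).2 h
    refine ⟨fun i hi => ?_, fun k hk => ?_⟩
    · exact lt_of_le_of_ne (hj.symm ▸ hle i hi.le) (σ.injective.ne hi.ne)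
    · have hcard : (Finset.Iic j).card ≤
          (Finset.univ.filter fun i : Fin n => i < k ∧ σ i < σ k).card := by
        refine Finset.card_le_card fun i hi => ?_
        have hij := Finset.mem_Iic.1 hi
        simpa using ⟨hij.trans_lt hk, (hle i hij).trans_lt (h k hk)⟩
      rw [Fin.card_Iic] at hcard
      rw [pnt]
      omega
  · rintro ⟨hj, h⟩
    have hlt : ∀ k, j < k → j < σ k := fun k hk => by
      have := h k hk
      have := pnt_le_apply σ k
      omega
    refine ⟨le_antisymm ((forall_apply_le_iff_forall_lt_apply σ j).2 hlt j le_rfl) ?_, hlt⟩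
    have := (pnt_eq_iff σ j).2 hj
    have := pnt_le_apply σ j
    omega
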